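/- Let $N\ge 1$, $s>0$, and $f\in L^2_1(\mathbb{R}^N)\cap H^s(\mathbb{R}^N)$ (so $\int|v|^2f(v)^2dv<\infty$ and $\int\langle\xi\rangle^{2s}|\hat f(\xi)|^2d\xi<\infty$). Then there is a constant $C_N$ depending only on $N$ such that for all $T$ with $|T-1|\le 1/2$, $\left\|\hat f-\hat f(T^{-1/2}\cdot)\right\|_{L^2}\le C_N\,\|f\|_{L^2_1}^{\frac{s}{1+s}}\,\|f\|_{H^s}^{\frac{1}{1+s}}\,|T-1|^{\frac{s}{2(1+s)}}$. -/

import Mathlib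

open MeasureTheory Real
open scoped RealInnerProductSpace

/-- The Fourier transform `f̂(ξ) = ∫ f(v) e^{-i ξ·v} dv`. -/
noncomputable def fourierT (N : ℕ) (f : EuclideanSpace ℝ (Fin N) → ℝ)
    (ξ : EuclideanSpace ℝ (Fin N)) : ℂ :=
  ∫ v, (f v : ℂ) * Complex.exp (-Complex.I * (⟪ξ, v⟫ : ℝ))

namespace FourierDilation

open FourierTransform ENNReal

section Plancherel

variable {V : Type*} [NormedAddCommGroup V] [InnerProductSpace ℝ V] [FiniteDimensional ℝ V]
  [MeasurableSpace V] [BorelSpace V]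

theorem continuous_fourier {h : V → ℂ} (h1 : Integrable h) :
    Continuous (𝓕 h) :=
  VectorFourier.fourierIntegral_continuous Real.continuous_fourierChar
    (by exact continuous_inner) h1

/-- The Fourier transform on `L²` is given by the Fourier integral on `L¹ ∩ L²`. -/
theorem coeFn_fourier_toLp {h : V → ℂ} (h1 : Integrable h)
    (h2 : MemLp h 2) : (𝓕 (h2.toLp h) : Lp ℂ 2 (volume : Measure V)) =ᵐ[volume] 𝓕 h := by
  have hc : Continuous (𝓕 h) := continuous_fourier h1
  refine ae_eq_of_integral_contDiff_smul_eq ?_ hc.locallyIntegrable ?_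
  · exact (Lp.memLp _).locallyIntegrable (by norm_num)
  intro g hg hgs
  let φ : SchwartzMap V ℂ := HasCompactSupport.toSchwartzMap
    (f := fun x => (g x : ℂ)) (hgs.comp_left (g := ((↑) : ℝ → ℂ)) (by simp))
    (Complex.ofRealCLM.contDiff.comp hg)
  have key := congrArg (fun D => D φ) (Lp.fourier_toTemperedDistribution_eq (h2.toLp h))
  simp only [TemperedDistribution.fourier_apply, Lp.toTemperedDistribution_apply] at key
  have e1 : ∫ x, (𝓕 φ : SchwartzMap V ℂ) x • (h2.toLp h) x = ∫ x, 𝓕 (φ : V → ℂ) x • h x := by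
    refine integral_congr_ae ?_
    filter_upwards [h2.coeFn_toLp] with x hx
    rw [hx, SchwartzMap.fourier_coe]
  have e2 : ∫ x, 𝓕 (φ : V → ℂ) x • h x = ∫ x, φ x • 𝓕 h x := by
    have := VectorFourier.integral_fourierIntegral_smul_eq_flip (μ := (volume : Measure V))
      (ν := (volume : Measure V)) (L := innerₗ V) (f := (φ : V → ℂ)) (g := h)
      Real.continuous_fourierChar (by exact continuous_inner) φ.integrable h1
    rwa [flip_innerₗ] at this
  have hφ : ∀ x, φ x = (g x : ℂ) := fun x => rfl
  have := key.symm.trans (e1.trans e2)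
  simpa [hφ, Complex.real_smul] using this

/-- Plancherel's theorem for the Fourier integral of a function in `L¹ ∩ L²`. -/
theorem lintegral_enorm_fourier_sq {h : V → ℂ} (h1 : Integrable h) (h2 : MemLp h 2) :
    ∫⁻ ξ, ‖𝓕 h ξ‖ₑ ^ 2 = ∫⁻ v, ‖h v‖ₑ ^ 2 := by
  have key : eLpNorm (𝓕 h) 2 volume = eLpNorm h 2 volume := by
    rw [← eLpNorm_congr_ae (coeFn_fourier_toLp h1 h2), ← eLpNorm_congr_ae h2.coeFn_toLp,
      ← Lp.enorm_def, ← Lp.enorm_def, ← ofReal_norm, Lp.norm_fourier_eq, ofReal_norm]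
  simp only [eLpNorm_eq_lintegral_rpow_enorm_toReal two_ne_zero ENNReal.ofNat_ne_top] at key
  simpa using ENNReal.rpow_left_injective (by norm_num) key

/-- Change of variables under a dilation, for the lower Lebesgue integral. -/
theorem lintegral_comp_smul_pos (g : V → ℝ≥0∞) {r : ℝ} (hr : 0 < r) :
    ∫⁻ x, g (r • x) = ENNReal.ofReal ((r ^ Module.finrank ℝ V)⁻¹) * ∫⁻ x, g x := by
  have := lintegral_map_equiv (μ := (volume : Measure V)) g
    (Homeomorph.smulOfNeZero r hr.ne').toMeasurableEquiv
  have h2 := Measure.map_addHaar_smul (volume : Measure V) hr.ne'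
  rw [abs_of_pos (by positivity)] at h2
  rw [← smul_eq_mul, ← lintegral_smul_measure, ← h2]
  exact this.symm

end Plancherel

section Dilation

variable {N : ℕ}

theorem integrable_coord_mul {h : EuclideanSpace ℝ (Fin N) → ℂ} (h1 : Integrable h)
    (hv : Integrable fun v => ‖v‖ * ‖h v‖) (j : Fin N) :
    Integrable fun v => (v j : ℂ) * h v := by
  refine hv.mono ?_ (.of_forall fun v => ?_)
  · exact (by fun_prop : Continuous fun v : EuclideanSpace ℝ (Fin N) =>
      (v j : ℂ)).aestronglyMeasurable.mul h1.aestronglyMeasurable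
  · rw [norm_mul, Complex.norm_real, norm_mul, norm_norm, norm_norm]
    gcongr
    exact PiLp.norm_apply_le v j

/-- The derivative of the Fourier transform along a ray. -/
theorem hasDerivAt_fourier_smul {h : EuclideanSpace ℝ (Fin N) → ℂ} (h1 : Integrable h)
    (hv : Integrable fun v => ‖v‖ * ‖h v‖) (ξ : EuclideanSpace ℝ (Fin N)) (t : ℝ) :
    HasDerivAt (fun t : ℝ => 𝓕 h (t • ξ))
      (-(2 * π * Complex.I) * ∑ j, (ξ j : ℂ) * 𝓕 (fun v => (v j : ℂ) * h v) (t • ξ)) t := by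
  have hs : HasDerivAt (fun t : ℝ => t • ξ) ξ t := by
    simpa using (hasDerivAt_id t).smul_const ξ
  have hd := (Real.hasFDerivAt_fourier h1 hv (t • ξ)).comp_hasDerivAt t hs
  have hi : Integrable (VectorFourier.fourierSMulRight (innerSL ℝ) h) := by
    refine (hv.const_mul (2 * π * ‖innerSL ℝ (E := EuclideanSpace ℝ (Fin N))‖)).mono'
      (h1.aestronglyMeasurable.fourierSMulRight (L := innerSL ℝ)) (.of_forall fun v => ?_)
    simpa [mul_assoc] using VectorFourier.norm_fourierSMulRight_le (innerSL ℝ) h v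
  convert! hd using 1
  rw [Real.fourier_continuousLinearMap_apply hi]
  have e : (fun v => VectorFourier.fourierSMulRight (innerSL ℝ) h v ξ) =
      fun v => -(2 * π * Complex.I) * ∑ j, (ξ j : ℂ) * ((v j : ℂ) * h v) := by
    ext v
    have hin : ((inner ℝ v ξ : ℝ) : ℂ) = ∑ j, (ξ j : ℂ) * (v j : ℂ) := by
      simp [PiLp.inner_apply]
    rw [VectorFourier.fourierSMulRight_apply, smul_eq_mul, Complex.real_smul,
      show innerSL ℝ v ξ = inner ℝ v ξ from rfl, hin, Finset.sum_mul]
    simp only [mul_assoc]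
  rw [e]
  simp only [Real.fourier_eq, Circle.smul_def, smul_eq_mul]
  have e2 : ∀ v : EuclideanSpace ℝ (Fin N), (𝐞 (-inner ℝ v (t • ξ)) : ℂ) *
      (-(2 * π * Complex.I) * ∑ j, (ξ j : ℂ) * ((v j : ℂ) * h v)) =
      -(2 * π * Complex.I) * ∑ j, (ξ j : ℂ) *
        ((𝐞 (-inner ℝ v (t • ξ)) : ℂ) * ((v j : ℂ) * h v)) := by
    intro v
    simp only [Finset.mul_sum]
    exact Finset.sum_congr rfl fun j _ => by ring
  simp only [e2]
  rw [integral_const_mul, integral_finsetSum]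
  · simp only [integral_const_mul]
  · intro j _
    have := (Real.fourierIntegral_convergent_iff (μ := volume) (t • ξ)).2
      (integrable_coord_mul h1 hv j)
    simpa [Circle.smul_def] using this.const_mul (ξ j : ℂ)

theorem enorm_fourier_smul_deriv_sq_le (c : Fin N → ℂ) (ξ : EuclideanSpace ℝ (Fin N)) :
    ‖-(2 * π * Complex.I) * ∑ j, (ξ j : ℂ) * c j‖ₑ ^ 2 ≤
      ENNReal.ofReal (4 * π ^ 2) * ‖ξ‖ₑ ^ 2 * ∑ j, ‖c j‖ₑ ^ 2 := by
  have h : ‖-(2 * π * Complex.I) * ∑ j, (ξ j : ℂ) * c j‖ ^ 2 ≤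
      4 * π ^ 2 * ‖ξ‖ ^ 2 * ∑ j, ‖c j‖ ^ 2 := by
    have h1 : ‖∑ j, (ξ j : ℂ) * c j‖ ≤ ∑ j, ‖ξ j‖ * ‖c j‖ :=
      (norm_sum_le _ _).trans_eq (by simp)
    have h2 := Finset.sum_mul_sq_le_sq_mul_sq Finset.univ (fun j => ‖ξ j‖) (fun j => ‖c j‖)
    rw [← EuclideanSpace.norm_sq_eq] at h2
    have h3 : ‖∑ j, (ξ j : ℂ) * c j‖ ^ 2 ≤ ‖ξ‖ ^ 2 * ∑ j, ‖c j‖ ^ 2 :=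
      (pow_le_pow_left₀ (norm_nonneg _) h1 2).trans h2
    calc _ = 4 * π ^ 2 * ‖∑ j, (ξ j : ℂ) * c j‖ ^ 2 := by
          rw [norm_mul, mul_pow]
          congr 1
          simp [abs_of_pos Real.pi_pos]
          ring
      _ ≤ _ := by
          rw [mul_assoc (4 * π ^ 2)]
          gcongr
  have := ENNReal.ofReal_le_ofReal h
  rw [ENNReal.ofReal_mul (by positivity), ENNReal.ofReal_mul (by positivity),
    ENNReal.ofReal_sum_of_nonneg (by intros; positivity)] at this
  simpa only [ENNReal.ofReal_pow (norm_nonneg _), ofReal_norm] using this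

/-- Cauchy–Schwarz for the increment of a `C¹` function. -/
theorem enorm_sub_sq_le_lintegral {φ φ' : ℝ → ℂ} (hd : ∀ t, HasDerivAt φ (φ' t) t)
    (hc : Continuous φ') (a b : ℝ) :
    ‖φ b - φ a‖ₑ ^ 2 ≤ ENNReal.ofReal |b - a| * ∫⁻ t in Set.uIoc a b, ‖φ' t‖ₑ ^ 2 := by
  have h1 : ‖φ b - φ a‖ₑ ≤ ∫⁻ t in Set.uIoc a b, ‖φ' t‖ₑ := by
    rw [← intervalIntegral.integral_eq_sub_of_hasDerivAt (fun t _ => hd t)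
      (hc.intervalIntegrable a b), ← ofReal_norm, intervalIntegral.norm_intervalIntegral_eq,
      ofReal_norm]
    exact enorm_integral_le_lintegral_enorm _
  have h2 := ENNReal.lintegral_mul_norm_pow_le (μ := volume.restrict (Set.uIoc a b))
    (f := fun _ => 1) (g := fun t => ‖φ' t‖ₑ ^ 2) aemeasurable_const
    (by fun_prop) (p := 1 / 2) (q := 1 / 2) (by norm_num) (by norm_num) (by norm_num)
  have e : ∀ x : ℝ≥0∞, (x ^ 2) ^ (1 / 2 : ℝ) = x := fun x => by
    rw [← ENNReal.rpow_natCast, ← ENNReal.rpow_mul]; norm_num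
  have e' : ∀ x : ℝ≥0∞, (x ^ (1 / 2 : ℝ)) ^ 2 = x := fun x => by
    rw [← ENNReal.rpow_natCast, ← ENNReal.rpow_mul]; norm_num
  simp only [e, ENNReal.one_rpow, one_mul, lintegral_const, Measure.restrict_apply_univ] at h2
  calc _ ≤ _ := pow_le_pow_left₀ zero_le (h1.trans h2) 2
    _ = _ := by
      rw [mul_pow, e', e', Set.uIoc, Real.volume_Ioc, max_sub_min_eq_abs]

/-- The weighted `L²` bound for a dilation increment of a Fourier transform, for functions with an
integrable first moment. -/
theorem lintegral_fourier_sub_dilation_le_of_integrable {h : EuclideanSpace ℝ (Fin N) → ℂ}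
    (h1 : Integrable h) (hv : Integrable fun v => ‖v‖ * ‖h v‖)
    {a : ℝ} (ha : 1 / 2 ≤ a) :
    ∫⁻ ξ, (‖ξ‖ₑ ^ 2)⁻¹ * ‖𝓕 h ξ - 𝓕 h (a • ξ)‖ₑ ^ 2 ≤
      ENNReal.ofReal (4 * π ^ 2 * 2 ^ N * |1 - a| ^ 2) * ∫⁻ v, ‖v‖ₑ ^ 2 * ‖h v‖ₑ ^ 2 := by
  set G : Fin N → EuclideanSpace ℝ (Fin N) → ℂ := fun j => 𝓕 (fun v => (v j : ℂ) * h v)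
  have hGc : ∀ j, Continuous (G j) := fun j => continuous_fourier (integrable_coord_mul h1 hv j)
  have hsum : ∑ j, ∫⁻ v, ‖(v j : ℂ) * h v‖ₑ ^ 2 = ∫⁻ v, ‖v‖ₑ ^ 2 * ‖h v‖ₑ ^ 2 := by
    rw [← lintegral_finsetSum']
    · refine lintegral_congr fun v => ?_
      have henorm : ∀ x : ℝ, ‖(x : ℂ)‖ₑ = ‖x‖ₑ := fun x => by
        rw [← ofReal_norm, Complex.norm_real, ofReal_norm]
      have : ‖v‖ₑ ^ 2 = ∑ j, ‖(v j : ℂ)‖ₑ ^ 2 := by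
        have := congrArg ENNReal.ofReal (EuclideanSpace.norm_sq_eq v)
        rw [ENNReal.ofReal_sum_of_nonneg (by intros; positivity)] at this
        simpa only [ENNReal.ofReal_pow (norm_nonneg _), ofReal_norm, henorm] using this
      simp only [enorm_mul, mul_pow, this, Finset.sum_mul]
    · intro j _
      exact (integrable_coord_mul h1 hv j).aestronglyMeasurable.enorm.pow_const 2
  have hpl : ∀ j, ∫⁻ ξ, ‖G j ξ‖ₑ ^ 2 ≤ ∫⁻ v, ‖(v j : ℂ) * h v‖ₑ ^ 2 := by
    intro j
    by_cases hfin : ∫⁻ v, ‖(v j : ℂ) * h v‖ₑ ^ 2 = ∞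
    · exact hfin ▸ le_top
    refine (lintegral_enorm_fourier_sq (integrable_coord_mul h1 hv j) ⟨?_, ?_⟩).le
    · exact (integrable_coord_mul h1 hv j).aestronglyMeasurable
    · rw [eLpNorm_lt_top_iff_lintegral_rpow_enorm_lt_top two_ne_zero ENNReal.ofNat_ne_top]
      simpa using Ne.lt_top hfin
  have hpt : ∀ ξ, (‖ξ‖ₑ ^ 2)⁻¹ * ‖𝓕 h ξ - 𝓕 h (a • ξ)‖ₑ ^ 2 ≤
      ENNReal.ofReal (|1 - a| * (4 * π ^ 2)) *
        ∫⁻ t in Set.uIoc a 1, ∑ j, ‖G j (t • ξ)‖ₑ ^ 2 := by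
    intro ξ
    have hcG : ∀ j, Continuous fun t : ℝ => G j (t • ξ) := fun j =>
      (hGc j).comp (by fun_prop)
    have k1 := enorm_sub_sq_le_lintegral (hasDerivAt_fourier_smul h1 hv ξ)
      (continuous_const.mul (continuous_finsetSum _ fun j _ => continuous_const.mul (hcG j))) a 1
    rw [one_smul] at k1
    have k2 : ∫⁻ t in Set.uIoc a 1,
        ‖-(2 * π * Complex.I) * ∑ j, (ξ j : ℂ) * G j (t • ξ)‖ₑ ^ 2 ≤
        ENNReal.ofReal (4 * π ^ 2) * ‖ξ‖ₑ ^ 2 * ∫⁻ t in Set.uIoc a 1, ∑ j, ‖G j (t • ξ)‖ₑ ^ 2 := by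
      rw [← lintegral_const_mul]
      · exact lintegral_mono fun t => enorm_fourier_smul_deriv_sq_le _ ξ
      · exact Finset.measurable_fun_sum _ fun j _ => (hcG j).enorm.measurable.pow_const 2
    calc _ ≤ (‖ξ‖ₑ ^ 2)⁻¹ * (ENNReal.ofReal |1 - a| * (ENNReal.ofReal (4 * π ^ 2) * ‖ξ‖ₑ ^ 2 *
            ∫⁻ t in Set.uIoc a 1, ∑ j, ‖G j (t • ξ)‖ₑ ^ 2)) := by
          gcongr
          exact k1.trans (by gcongr)
      _ = ((‖ξ‖ₑ ^ 2)⁻¹ * ‖ξ‖ₑ ^ 2) * (ENNReal.ofReal (|1 - a| * (4 * π ^ 2)) *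
            ∫⁻ t in Set.uIoc a 1, ∑ j, ‖G j (t • ξ)‖ₑ ^ 2) := by
          rw [ENNReal.ofReal_mul (abs_nonneg _)]
          ring
      _ ≤ _ := by
          refine mul_le_of_le_one_left zero_le ?_
          rw [mul_comm, ← div_eq_mul_inv]
          exact ENNReal.div_self_le_one
  have hcG2 : ∀ j, Continuous fun p : EuclideanSpace ℝ (Fin N) × ℝ => G j (p.2 • p.1) := fun j =>
    (hGc j).comp (by fun_prop)
  have hms : Measurable fun p : EuclideanSpace ℝ (Fin N) × ℝ => ∑ j, ‖G j (p.2 • p.1)‖ₑ ^ 2 :=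
    Finset.measurable_fun_sum _ fun j _ => (hcG2 j).enorm.measurable.pow_const 2
  calc _ ≤ ∫⁻ ξ, ENNReal.ofReal (|1 - a| * (4 * π ^ 2)) *
        ∫⁻ t in Set.uIoc a 1, ∑ j, ‖G j (t • ξ)‖ₑ ^ 2 := lintegral_mono hpt
    _ = ENNReal.ofReal (|1 - a| * (4 * π ^ 2)) *
        ∫⁻ t in Set.uIoc a 1, ∫⁻ ξ, ∑ j, ‖G j (t • ξ)‖ₑ ^ 2 := by
      rw [lintegral_const_mul _ hms.lintegral_prod_right', lintegral_lintegral_swap]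
      exact hms.aemeasurable
    _ ≤ ENNReal.ofReal (|1 - a| * (4 * π ^ 2)) *
        ∫⁻ t in Set.uIoc a 1, ENNReal.ofReal (2 ^ N) * ∫⁻ v, ‖v‖ₑ ^ 2 * ‖h v‖ₑ ^ 2 := by
      refine mul_le_mul_right ?_ _
      refine setLIntegral_mono measurable_const fun t ht => ?_
      have ht2 : 1 / 2 ≤ t := (le_min ha (by norm_num)).trans ht.1.le
      have ht0 : 0 < t := by linarith
      rw [lintegral_comp_smul_pos (fun ξ => ∑ j, ‖G j ξ‖ₑ ^ 2) ht0, finrank_euclideanSpace_fin,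
        lintegral_finsetSum _ (fun j _ => (hGc j).enorm.measurable.pow_const 2), ← hsum]
      refine mul_le_mul' (ENNReal.ofReal_le_ofReal ?_) (Finset.sum_le_sum fun j _ => hpl j)
      rw [← inv_pow]
      refine pow_le_pow_left₀ (by positivity) ?_ N
      rw [inv_le_comm₀ ht0 two_pos]
      linarith
    _ = _ := by
      have e : ENNReal.ofReal (4 * π ^ 2 * 2 ^ N * |1 - a| ^ 2) =
          ENNReal.ofReal (|1 - a| * (4 * π ^ 2)) *
            (ENNReal.ofReal (2 ^ N) * ENNReal.ofReal |1 - a|) := by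
        rw [← ENNReal.ofReal_mul (by positivity), ← ENNReal.ofReal_mul (by positivity)]
        congr 1
        ring
      rw [setLIntegral_const, Set.uIoc, Real.volume_Ioc, max_sub_min_eq_abs, e]
      ring

/-- The weighted `L²` bound for a dilation increment of the Fourier transform. -/
theorem lintegral_fourier_sub_dilation_le {h : EuclideanSpace ℝ (Fin N) → ℂ}
    (h1 : Integrable h) {a : ℝ} (ha : 1 / 2 ≤ a) :
    ∫⁻ ξ, (‖ξ‖ₑ ^ 2)⁻¹ * ‖𝓕 h ξ - 𝓕 h (a • ξ)‖ₑ ^ 2 ≤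
      ENNReal.ofReal (4 * π ^ 2 * 2 ^ N * |1 - a| ^ 2) * ∫⁻ v, ‖v‖ₑ ^ 2 * ‖h v‖ₑ ^ 2 := by
  set k : ℕ → EuclideanSpace ℝ (Fin N) → ℂ := fun n => (Metric.ball 0 (n : ℝ)).indicator h with hk
  have hk1 : ∀ n, Integrable (k n) := fun n => h1.indicator measurableSet_ball
  have hkle : ∀ n v, ‖k n v‖ ≤ ‖h v‖ := fun n v => norm_indicator_le_norm_self _ _
  have hkv : ∀ n, Integrable fun v => ‖v‖ * ‖k n v‖ := by
    intro n
    refine (h1.norm.const_mul (n : ℝ)).mono'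
      (continuous_norm.aestronglyMeasurable.mul (hk1 n).aestronglyMeasurable.norm)
      (.of_forall fun v => ?_)
    rw [norm_mul, norm_norm, norm_norm]
    by_cases hv : v ∈ Metric.ball (0 : EuclideanSpace ℝ (Fin N)) (n : ℝ)
    · rw [mem_ball_zero_iff] at hv
      exact mul_le_mul hv.le (hkle n v) (norm_nonneg _) n.cast_nonneg
    · simp only [hk, Set.indicator_of_notMem hv, norm_zero, mul_zero]
      positivity
  have hlim : ∀ ξ, Filter.Tendsto (fun n => 𝓕 (k n) ξ) Filter.atTop (nhds (𝓕 h ξ)) := by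
    intro ξ
    simp only [Real.fourier_eq]
    refine tendsto_integral_of_dominated_convergence (fun v => ‖h v‖) (fun n => ?_) h1.norm
      (fun n => .of_forall fun v => ?_) (.of_forall fun v => ?_)
    · exact ((Real.fourierIntegral_convergent_iff (μ := volume) ξ).2 (hk1 n)).aestronglyMeasurable
    · rw [Circle.norm_smul]
      exact hkle n v
    · refine tendsto_const_nhds.congr' ?_
      obtain ⟨m, hm⟩ := exists_nat_gt ‖v‖
      filter_upwards [Filter.eventually_ge_atTop m] with n hn
      have : v ∈ Metric.ball (0 : EuclideanSpace ℝ (Fin N)) (n : ℝ) := by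
        rw [mem_ball_zero_iff]
        exact hm.trans_le (by exact_mod_cast hn)
      simp only [hk, Set.indicator_of_mem this]
  have hmono : ∀ n, ∫⁻ ξ, (‖ξ‖ₑ ^ 2)⁻¹ * ‖𝓕 (k n) ξ - 𝓕 (k n) (a • ξ)‖ₑ ^ 2 ≤
      ENNReal.ofReal (4 * π ^ 2 * 2 ^ N * |1 - a| ^ 2) * ∫⁻ v, ‖v‖ₑ ^ 2 * ‖h v‖ₑ ^ 2 := by
    intro n
    refine (lintegral_fourier_sub_dilation_le_of_integrable (hk1 n) (hkv n) ha).trans ?_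
    gcongr with v
    exact enorm_le_iff_norm_le.2 (hkle n v)
  have hcont : ∀ n, Continuous fun ξ => 𝓕 (k n) ξ - 𝓕 (k n) (a • ξ) := fun n =>
    (continuous_fourier (hk1 n)).sub ((continuous_fourier (hk1 n)).comp (by fun_prop))
  refine le_trans (lintegral_mono_ae ?_) ((lintegral_liminf_le (u := Filter.atTop) (f := fun n ξ =>
    (‖ξ‖ₑ ^ 2)⁻¹ * ‖𝓕 (k n) ξ - 𝓕 (k n) (a • ξ)‖ₑ ^ 2) (fun n => ?_)).trans ?_)
  · refine .of_forall fun ξ => (Filter.Tendsto.liminf_eq ?_).ge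
    by_cases hξ : ξ = 0
    · simp [hξ]
    · refine ENNReal.Tendsto.const_mul ?_ (Or.inr (by simp [hξ]))
      exact ((ENNReal.continuous_pow 2).tendsto _).comp
        ((continuous_enorm.tendsto _).comp ((hlim ξ).sub (hlim (a • ξ))))
  · exact (by fun_prop : Measurable fun ξ : EuclideanSpace ℝ (Fin N) => (‖ξ‖ₑ ^ 2)⁻¹).mul
      ((hcont n).enorm.measurable.pow_const 2)
  · exact Filter.liminf_le_of_le (by isBoundedDefault) fun b hb =>
      let ⟨n, hn⟩ := hb.exists
      hn.trans (hmono n)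

theorem fourierT_eq_fourier (f : EuclideanSpace ℝ (Fin N) → ℝ) (ξ : EuclideanSpace ℝ (Fin N)) :
    fourierT N f ξ = 𝓕 (fun v => (f v : ℂ)) ((2 * π)⁻¹ • ξ) := by
  rw [fourierT, Real.fourier_eq']
  refine integral_congr_ae (.of_forall fun v => ?_)
  have : (-2 * π * inner ℝ v ((2 * π)⁻¹ • ξ) : ℝ) = -inner ℝ ξ v := by
    rw [real_inner_smul_right, real_inner_comm]
    field_simp
  simp only [this, smul_eq_mul]
  rw [mul_comm]
  congr 2
  push_cast
  ring

theorem continuous_fourierT {f : EuclideanSpace ℝ (Fin N) → ℝ} (hf : Integrable f) :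
    Continuous (fourierT N f) := by
  rw [show fourierT N f = _ from funext (fourierT_eq_fourier f)]
  exact (continuous_fourier (hf.ofReal (𝕜 := ℂ))).comp (by fun_prop)

theorem lintegral_fourierT_sub_dilation_le {f : EuclideanSpace ℝ (Fin N) → ℝ}
    (hf : Integrable f) {a : ℝ} (ha : 1 / 2 ≤ a) :
    ∫⁻ ξ, (‖ξ‖ₑ ^ 2)⁻¹ * ‖fourierT N f ξ - fourierT N f (a • ξ)‖ₑ ^ 2 ≤
      ENNReal.ofReal ((4 * π) ^ N * |1 - a| ^ 2) * ∫⁻ v, ‖v‖ₑ ^ 2 * ‖f v‖ₑ ^ 2 := by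
  set Φ := 𝓕 (fun v => (f v : ℂ))
  set c : ℝ := (2 * π)⁻¹ with hc
  have hc0 : 0 < c := by positivity
  set Ψ : EuclideanSpace ℝ (Fin N) → ℝ≥0∞ := fun x =>
    (‖x‖ₑ ^ 2)⁻¹ * ‖Φ x - Φ (a • x)‖ₑ ^ 2 with hΨ
  have hpt : ∀ ξ, (‖ξ‖ₑ ^ 2)⁻¹ * ‖fourierT N f ξ - fourierT N f (a • ξ)‖ₑ ^ 2 =
      ENNReal.ofReal (c ^ 2) * Ψ (c • ξ) := by
    intro ξ
    have hw : ‖c • ξ‖ₑ ^ 2 = ENNReal.ofReal (c ^ 2) * ‖ξ‖ₑ ^ 2 := by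
      rw [enorm_smul, mul_pow, Real.enorm_of_nonneg hc0.le, ENNReal.ofReal_pow hc0.le]
    have hc2 : ENNReal.ofReal (c ^ 2) ≠ 0 := by simpa using hc0.ne'
    rw [hΨ, fourierT_eq_fourier, fourierT_eq_fourier]
    simp only
    rw [hw, ENNReal.mul_inv (Or.inl hc2) (Or.inl ENNReal.ofReal_ne_top), smul_comm a, ← mul_assoc,
      ← mul_assoc, ENNReal.mul_inv_cancel hc2 ENNReal.ofReal_ne_top, one_mul]
  have henorm : ∀ v, ‖((f v : ℝ) : ℂ)‖ₑ = ‖f v‖ₑ := fun v => by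
    rw [← ofReal_norm, Complex.norm_real, ofReal_norm]
  simp only [hpt]
  rw [lintegral_const_mul' _ _ ENNReal.ofReal_ne_top, lintegral_comp_smul_pos Ψ hc0,
    finrank_euclideanSpace_fin]
  have key := lintegral_fourier_sub_dilation_le (hf.ofReal (𝕜 := ℂ)) ha
  calc _ ≤ ENNReal.ofReal (c ^ 2) * (ENNReal.ofReal (c ^ N)⁻¹ *
        (ENNReal.ofReal (4 * π ^ 2 * 2 ^ N * |1 - a| ^ 2) *
          ∫⁻ v, ‖v‖ₑ ^ 2 * ‖((f v : ℝ) : ℂ)‖ₑ ^ 2)) := by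
        gcongr
        exact key
    _ = _ := by
        simp only [henorm]
        rw [← mul_assoc, ← mul_assoc, ← ENNReal.ofReal_mul (by positivity),
          ← ENNReal.ofReal_mul (by positivity)]
        congr 2
        rw [hc, inv_pow, inv_pow, inv_inv, show (4 * π) ^ N = (2 * π) ^ N * 2 ^ N by
          rw [← mul_pow]; ring_nf]
        field_simp
        ring

/-- The homogeneous `Ḣˢ`-type bound for a dilation increment. -/
theorem lintegral_rpow_mul_sub_dilation_le {F : EuclideanSpace ℝ (Fin N) → ℂ} (hF : Measurable F)
    {s a : ℝ} (hs : 0 < s) (ha : 1 / 2 ≤ a) :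
    ∫⁻ ξ, (‖ξ‖ₑ ^ 2) ^ s * ‖F ξ - F (a • ξ)‖ₑ ^ 2 ≤
      2 ^ (N + 2) * 4 ^ s * ∫⁻ ξ, (‖ξ‖ₑ ^ 2) ^ s * ‖F ξ‖ₑ ^ 2 := by
  have ha0 : 0 < a := by linarith
  set I := ∫⁻ ξ, (‖ξ‖ₑ ^ 2) ^ s * ‖F ξ‖ₑ ^ 2
  have h4 : (1 : ℝ≥0∞) ≤ 4 ^ s := ENNReal.one_le_rpow (by norm_num) hs
  have h2N : (1 : ℝ≥0∞) ≤ 2 ^ N := one_le_pow₀ (by norm_num)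
  have hw : ∀ ξ : EuclideanSpace ℝ (Fin N), (‖ξ‖ₑ ^ 2) ^ s ≤ 4 ^ s * (‖a • ξ‖ₑ ^ 2) ^ s := by
    intro ξ
    rw [← ENNReal.mul_rpow_of_nonneg _ _ hs.le]
    refine ENNReal.rpow_le_rpow ?_ hs.le
    rw [show (4 : ℝ≥0∞) = 2 ^ 2 by norm_num, ← mul_pow]
    gcongr
    have : ‖ξ‖ ≤ 2 * ‖a • ξ‖ := by
      rw [norm_smul, Real.norm_of_nonneg ha0.le]
      nlinarith [norm_nonneg ξ]
    simpa only [ENNReal.ofReal_mul zero_le_two, ofReal_norm, ENNReal.ofReal_ofNat] using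
      ENNReal.ofReal_le_ofReal this
  have hsq : ∀ x y : ℂ, ‖x - y‖ₑ ^ 2 ≤ 2 * ‖x‖ₑ ^ 2 + 2 * ‖y‖ₑ ^ 2 := by
    intro x y
    have : ‖x - y‖ ^ 2 ≤ 2 * ‖x‖ ^ 2 + 2 * ‖y‖ ^ 2 := by
      have := pow_le_pow_left₀ (norm_nonneg _) (norm_sub_le x y) 2
      nlinarith [sq_nonneg (‖x‖ - ‖y‖)]
    have := ENNReal.ofReal_le_ofReal this
    rw [ENNReal.ofReal_add (by positivity) (by positivity), ENNReal.ofReal_mul (by norm_num),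
      ENNReal.ofReal_mul (by norm_num)] at this
    simpa only [ENNReal.ofReal_pow (norm_nonneg _), ofReal_norm, ENNReal.ofReal_ofNat] using this
  have hdil : ∫⁻ ξ, (‖a • ξ‖ₑ ^ 2) ^ s * ‖F (a • ξ)‖ₑ ^ 2 ≤ 2 ^ N * I := by
    rw [lintegral_comp_smul_pos (fun ξ => (‖ξ‖ₑ ^ 2) ^ s * ‖F ξ‖ₑ ^ 2) ha0,
      finrank_euclideanSpace_fin]
    gcongr
    rw [show (2 : ℝ≥0∞) ^ N = ENNReal.ofReal (2 ^ N) by simp [ENNReal.ofReal_pow], ← inv_pow]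
    refine ENNReal.ofReal_le_ofReal (pow_le_pow_left₀ (by positivity) ?_ N)
    rw [inv_le_comm₀ ha0 two_pos]
    linarith
  have hm1 : Measurable fun ξ => (‖ξ‖ₑ ^ 2) ^ s * ‖F ξ‖ₑ ^ 2 := by fun_prop
  have hm2 : Measurable fun ξ => (‖a • ξ‖ₑ ^ 2) ^ s * ‖F (a • ξ)‖ₑ ^ 2 :=
    hm1.comp (measurable_const_smul a)
  calc _ ≤ ∫⁻ ξ, (2 * ((‖ξ‖ₑ ^ 2) ^ s * ‖F ξ‖ₑ ^ 2) +
        2 * 4 ^ s * ((‖a • ξ‖ₑ ^ 2) ^ s * ‖F (a • ξ)‖ₑ ^ 2)) := by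
        refine lintegral_mono fun ξ => ?_
        calc _ ≤ (‖ξ‖ₑ ^ 2) ^ s * (2 * ‖F ξ‖ₑ ^ 2 + 2 * ‖F (a • ξ)‖ₑ ^ 2) := by
              gcongr
              exact hsq _ _
          _ = 2 * ((‖ξ‖ₑ ^ 2) ^ s * ‖F ξ‖ₑ ^ 2) +
              2 * (‖ξ‖ₑ ^ 2) ^ s * ‖F (a • ξ)‖ₑ ^ 2 := by ring
          _ ≤ 2 * ((‖ξ‖ₑ ^ 2) ^ s * ‖F ξ‖ₑ ^ 2) +
              2 * (4 ^ s * (‖a • ξ‖ₑ ^ 2) ^ s) * ‖F (a • ξ)‖ₑ ^ 2 := by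
              gcongr
              exact hw ξ
          _ = _ := by ring
    _ = 2 * I + 2 * 4 ^ s * ∫⁻ ξ, (‖a • ξ‖ₑ ^ 2) ^ s * ‖F (a • ξ)‖ₑ ^ 2 := by
        rw [lintegral_add_left (hm1.const_mul _), lintegral_const_mul _ hm1,
          lintegral_const_mul _ hm2]
    _ ≤ 2 * (2 ^ N * 4 ^ s * I) + 2 * 4 ^ s * (2 ^ N * I) := by
        gcongr
        exact le_mul_of_one_le_left zero_le (one_le_mul h2N h4)
    _ = _ := by ring

/-- Interpolation between the weights `‖ξ‖⁻²` and `‖ξ‖²ˢ`. -/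
theorem lintegral_enorm_sq_le_interpolation {g : EuclideanSpace ℝ (Fin N) → ℂ} (hg : Measurable g)
    (hg0 : g 0 = 0) {s : ℝ} (hs : 0 < s) :
    ∫⁻ ξ, ‖g ξ‖ₑ ^ 2 ≤ (∫⁻ ξ, (‖ξ‖ₑ ^ 2)⁻¹ * ‖g ξ‖ₑ ^ 2) ^ (s / (1 + s)) *
      (∫⁻ ξ, (‖ξ‖ₑ ^ 2) ^ s * ‖g ξ‖ₑ ^ 2) ^ (1 / (1 + s)) := by
  have hs1 : 0 < 1 + s := by linarith
  have hp : 0 ≤ s / (1 + s) := by positivity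
  have hq : 0 ≤ 1 / (1 + s) := by positivity
  have hpq : s / (1 + s) + 1 / (1 + s) = 1 := by field_simp; ring
  refine le_trans (lintegral_mono fun ξ => ?_)
    (ENNReal.lintegral_mul_norm_pow_le (by fun_prop) (by fun_prop) hp hq hpq)
  by_cases hξ : ξ = 0
  · simp [hξ, hg0]
  have hw0 : ‖ξ‖ₑ ^ 2 ≠ 0 := by simpa using hξ
  have hwt : ‖ξ‖ₑ ^ 2 ≠ ∞ := by simp
  refine le_of_eq ?_
  generalize ‖ξ‖ₑ ^ 2 = w at hw0 hwt
  rw [ENNReal.mul_rpow_of_nonneg _ _ hp, ENNReal.mul_rpow_of_nonneg _ _ hq, mul_mul_mul_comm,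
    ← ENNReal.rpow_add_of_nonneg _ _ hp hq, hpq, ENNReal.rpow_one, ← ENNReal.rpow_mul,
    ENNReal.inv_rpow, mul_one_div, ENNReal.inv_mul_cancel, one_mul]
  · simp [ENNReal.rpow_eq_zero_iff, hw0, hwt]
  · simp [ENNReal.rpow_eq_top_iff, hw0, hwt]

end Dilation

section Scalar

theorem inv_sqrt_dilation_bounds {T : ℝ} (hT : |T - 1| ≤ 1 / 2) :
    1 / 2 ≤ T ^ (-(1 : ℝ) / 2) ∧ |1 - T ^ (-(1 : ℝ) / 2)| ^ 2 ≤ |T - 1| := by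
  obtain ⟨h1, h2⟩ := abs_le.1 hT
  have hT0 : 0 < T := by linarith
  set r := √T with hr
  have hr2 : r ^ 2 = T := Real.sq_sqrt hT0.le
  have hr0 : 0 < r := Real.sqrt_pos.2 hT0
  have e : T ^ (-(1 : ℝ) / 2) = r⁻¹ := by
    rw [neg_div, Real.rpow_neg hT0.le, ← Real.sqrt_eq_rpow]
  have hr1 : 1 / 2 ≤ r := by nlinarith
  have hr3 : r ≤ 2 := by nlinarith
  rw [e]
  refine ⟨by rw [one_div]; exact inv_anti₀ hr0 hr3, ?_⟩
  have h3 : |1 - r⁻¹| ≤ |T - 1| := by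
    have : T - 1 = (1 - r⁻¹) * (r * (r + 1)) := by
      rw [← hr2]
      field_simp
      ring
    rw [this, abs_mul]
    refine le_mul_of_one_le_right (abs_nonneg _) (le_trans ?_ (le_abs_self _))
    nlinarith
  calc |1 - r⁻¹| ^ 2 ≤ |T - 1| ^ 2 := by gcongr
    _ ≤ |T - 1| := by nlinarith [abs_nonneg (T - 1)]

theorem rpow_interpolation_const_le {K : ℝ} (hK : 1 ≤ K) (N : ℕ) {s m η δ τ : ℝ} (hs : 0 < s)
    (hm : 0 ≤ m) (hη : 0 ≤ η) (hδ : 0 ≤ δ) (hδτ : δ ≤ τ) :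
    ((K * δ * m) ^ (s / (1 + s)) * (2 ^ (N + 2) * 4 ^ s * η) ^ (1 / (1 + s))) ^ ((1 : ℝ) / 2) ≤
      K * 2 ^ (N + 2) * 4 * m ^ (s / (2 * (1 + s))) * η ^ (1 / (2 * (1 + s))) *
        τ ^ (s / (2 * (1 + s))) := by
  have hs1 : 0 < 1 + s := by linarith
  have hτ : 0 ≤ τ := hδ.trans hδτ
  have hK0 : 0 ≤ K := by linarith
  set p := s / (2 * (1 + s)) with hp
  set q := 1 / (2 * (1 + s)) with hq
  have hp0 : 0 ≤ p := by positivity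
  have hq0 : 0 ≤ q := by positivity
  have hp1 : p ≤ 1 := by rw [hp, div_le_one (by positivity)]; linarith
  have hq1 : q ≤ 1 := by rw [hq, div_le_one (by positivity)]; linarith
  have hsq : s * q = p := by rw [hp, hq]; ring
  have e1 : s / (1 + s) * (1 / 2) = p := by rw [hp]; field_simp
  have e2 : 1 / (1 + s) * (1 / 2) = q := by rw [hq]; field_simp
  have h2N : (1 : ℝ) ≤ 2 ^ (N + 2) := one_le_pow₀ (by norm_num)
  have k1 : K ^ p ≤ K := Real.rpow_le_self_of_one_le hK hp1
  have k2 : ((2 : ℝ) ^ (N + 2)) ^ q ≤ 2 ^ (N + 2) := Real.rpow_le_self_of_one_le h2N hq1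
  have k3 : (4 : ℝ) ^ p ≤ 4 := Real.rpow_le_self_of_one_le (by norm_num) hp1
  have k4 : δ ^ p ≤ τ ^ p := Real.rpow_le_rpow hδ hδτ hp0
  rw [Real.mul_rpow (by positivity) (by positivity), ← Real.rpow_mul (by positivity),
    ← Real.rpow_mul (by positivity), e1, e2, Real.mul_rpow (by positivity) hm,
    Real.mul_rpow hK0 hδ, Real.mul_rpow (by positivity) hη,
    Real.mul_rpow (by positivity) (by positivity), ← Real.rpow_mul (by norm_num), hsq]
  calc K ^ p * δ ^ p * m ^ p * (((2 : ℝ) ^ (N + 2)) ^ q * 4 ^ p * η ^ q)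
      ≤ K * τ ^ p * m ^ p * (2 ^ (N + 2) * 4 * η ^ q) := by gcongr
    _ = _ := by ring

end Scalar

end FourierDilation

/-- there is a constant `C_N`, depending only on `N`, such that for every
`s > 0`, `f ∈ L²₁ ∩ H^s` and `|T - 1| ≤ 1/2`,
`‖f̂ - f̂(T^{-1/2}·)‖_{L²} ≤ C_N ‖f‖_{L²₁}^{s/(1+s)} ‖f‖_{H^s}^{1/(1+s)} |T-1|^{s/(2(1+s))}`. -/
theorem stmt10 (N : ℕ) (hN : 1 ≤ N) :
    ∃ C : ℝ, 0 < C ∧ ∀ (s : ℝ), 0 < s →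
      ∀ f : EuclideanSpace ℝ (Fin N) → ℝ, Integrable f →
        Integrable (fun v => (1 + ‖v‖ ^ 2) * (f v) ^ 2) →
        Integrable (fun ξ => (1 + ‖ξ‖ ^ 2) ^ s * ‖fourierT N f ξ‖ ^ 2) →
        ∀ T : ℝ, |T - 1| ≤ 1 / 2 →
          (∫ ξ, ‖fourierT N f ξ - fourierT N f (T ^ (-(1 : ℝ) / 2) • ξ)‖ ^ 2) ^ ((1 : ℝ) / 2)
            ≤ C * (∫ v, (1 + ‖v‖ ^ 2) * (f v) ^ 2) ^ (s / (2 * (1 + s)))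
              * (∫ ξ, (1 + ‖ξ‖ ^ 2) ^ s * ‖fourierT N f ξ‖ ^ 2) ^ (1 / (2 * (1 + s)))
              * |T - 1| ^ (s / (2 * (1 + s))) := by
  have hK : 1 ≤ (4 * π) ^ N := one_le_pow₀ (by linarith [Real.pi_gt_three])
  refine ⟨(4 * π) ^ N * 2 ^ (N + 2) * 4, by positivity, ?_⟩
  intro s hs f hf hm hη T hT
  obtain ⟨ha, hδ⟩ := FourierDilation.inv_sqrt_dilation_bounds hT
  set a := T ^ (-(1 : ℝ) / 2)
  set m := ∫ v, (1 + ‖v‖ ^ 2) * (f v) ^ 2 with hmdef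
  set η := ∫ ξ, (1 + ‖ξ‖ ^ 2) ^ s * ‖fourierT N f ξ‖ ^ 2 with hηdef
  have hm0 : 0 ≤ m := integral_nonneg fun v => by positivity
  have hη0 : 0 ≤ η := integral_nonneg fun v => by positivity
  refine le_trans ?_ (FourierDilation.rpow_interpolation_const_le hK N hs hm0 hη0
    (sq_nonneg |1 - a|) hδ)
  have hFc : Continuous (fourierT N f) := FourierDilation.continuous_fourierT hf
  have hgc : Continuous fun ξ => fourierT N f ξ - fourierT N f (a • ξ) :=
    hFc.sub (hFc.comp (continuous_const_smul a))
  have hM : ∫⁻ v, ‖v‖ₑ ^ 2 * ‖f v‖ₑ ^ 2 ≤ ENNReal.ofReal m := by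
    rw [hmdef, ofReal_integral_eq_lintegral_ofReal hm (.of_forall fun v => by positivity)]
    refine lintegral_mono fun v => ?_
    rw [← ofReal_norm, ← ofReal_norm, ← ENNReal.ofReal_pow (norm_nonneg _),
      ← ENNReal.ofReal_pow (norm_nonneg _), ← ENNReal.ofReal_mul (by positivity)]
    refine ENNReal.ofReal_le_ofReal ?_
    rw [Real.norm_eq_abs (f v), sq_abs]
    nlinarith [sq_nonneg (f v)]
  have hH : ∫⁻ ξ, (‖ξ‖ₑ ^ 2) ^ s * ‖fourierT N f ξ‖ₑ ^ 2 ≤ ENNReal.ofReal η := by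
    rw [hηdef, ofReal_integral_eq_lintegral_ofReal hη (.of_forall fun v => by positivity)]
    refine lintegral_mono fun v => ?_
    rw [← ofReal_norm, ← ofReal_norm, ← ENNReal.ofReal_pow (norm_nonneg _),
      ← ENNReal.ofReal_pow (norm_nonneg _), ENNReal.ofReal_rpow_of_nonneg (by positivity) hs.le,
      ← ENNReal.ofReal_mul (by positivity)]
    refine ENNReal.ofReal_le_ofReal ?_
    gcongr
    linarith
  have hs1 : 0 < 1 + s := by linarith
  have key : ∫⁻ ξ, ‖fourierT N f ξ - fourierT N f (a • ξ)‖ₑ ^ 2 ≤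
      ENNReal.ofReal (((4 * π) ^ N * |1 - a| ^ 2 * m) ^ (s / (1 + s)) *
        (2 ^ (N + 2) * 4 ^ s * η) ^ (1 / (1 + s))) := by
    refine (FourierDilation.lintegral_enorm_sq_le_interpolation hgc.measurable (by simp) hs).trans ?_
    rw [ENNReal.ofReal_mul (by positivity),
      ← ENNReal.ofReal_rpow_of_nonneg (by positivity) (by positivity),
      ← ENNReal.ofReal_rpow_of_nonneg (by positivity) (by positivity)]
    refine mul_le_mul' (ENNReal.rpow_le_rpow ?_ (by positivity))
      (ENNReal.rpow_le_rpow ?_ (by positivity))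
    · rw [ENNReal.ofReal_mul (by positivity)]
      exact (FourierDilation.lintegral_fourierT_sub_dilation_le hf ha).trans (by gcongr)
    · refine (FourierDilation.lintegral_rpow_mul_sub_dilation_le hFc.measurable hs ha).trans ?_
      rw [ENNReal.ofReal_mul (by positivity), ENNReal.ofReal_mul (by positivity),
        ENNReal.ofReal_pow (by norm_num),
        ← ENNReal.ofReal_rpow_of_nonneg (by norm_num) hs.le,
        ENNReal.ofReal_ofNat, ENNReal.ofReal_ofNat]
      gcongr
  refine Real.rpow_le_rpow (integral_nonneg fun ξ => by positivity) ?_ (by norm_num)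
  have hg2 : Continuous fun ξ => ‖fourierT N f ξ - fourierT N f (a • ξ)‖ ^ 2 := hgc.norm.pow 2
  rw [integral_eq_lintegral_of_nonneg_ae (.of_forall fun ξ => by positivity)
    hg2.aestronglyMeasurable]
  refine ENNReal.toReal_le_of_le_ofReal (by positivity) ?_
  simpa only [ENNReal.ofReal_pow (norm_nonneg _), ofReal_norm] using key
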